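/- For every f∈W, the identity J_α[(z∂/∂z − ū∂/∂ū) f](φ,s) = (1/i)·∂/∂φ [J_α f](φ,s) holds. -/

import Mathlib

open MeasureTheory Metric Set
open scoped Real

noncomputable section

/-- The open unit disk in ℂ. -/
def Disk : Set ℂ := Metric.ball (0 : ℂ) 1

/-- The weight `(1-|z|²)^(α-2)`. -/
def wt (α : ℝ) (z : ℂ) : ℝ := (1 - ‖z‖ ^ 2) ^ (α - 2)

/-- The kernel `K_α(φ,s;z,u)`. -/
def Kker (α : ℝ) (φ : ℝ) (s : ℂ) (z u : ℂ) : ℂ :=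
  (1 - (starRingEnd ℂ z) * Complex.exp (Complex.I * φ)) ^ (-(1/2 : ℂ) - Complex.I * s) *
  (1 - u * Complex.exp (-(Complex.I * φ))) ^ (-(1/2 : ℂ) - Complex.I * s) *
  (1 - (starRingEnd ℂ z) * u) ^ (-((α : ℂ) - 1/2 - Complex.I * s))

/-- The operator `J_α`; the second argument of `f` represents `ū`. -/
def Jop (α : ℝ) (f : ℂ → ℂ → ℂ) (φ : ℝ) (s : ℂ) : ℂ :=
  ∫ p in Disk ×ˢ Disk,
    Kker α φ s p.1 p.2 * f p.1 (starRingEnd ℂ p.2) * (wt α p.1 : ℂ) * (wt α p.2 : ℂ)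

/-- Membership in `H_α ⊗ H̄_α` (functions of `(z, ū)`). -/
def MemHT (α : ℝ) (f : ℂ → ℂ → ℂ) : Prop :=
  DifferentiableOn ℂ (fun p : ℂ × ℂ => f p.1 p.2) (Disk ×ˢ Disk) ∧
  IntegrableOn (fun p : ℂ × ℂ => ‖f p.1 p.2‖ ^ 2 * wt α p.1 * wt α p.2) (Disk ×ˢ Disk)

/-- Membership in `W`: analytic continuation to a larger bidisk. -/
def MemW (α : ℝ) (f : ℂ → ℂ → ℂ) : Prop :=
  MemHT α f ∧ ∃ δ > (0:ℝ), ∃ g : ℂ → ℂ → ℂ,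
    DifferentiableOn ℂ (fun p : ℂ × ℂ => g p.1 p.2)
      (Metric.ball (0:ℂ) (1+δ) ×ˢ Metric.ball (0:ℂ) (1+δ)) ∧
    ∀ p ∈ Disk ×ˢ Disk, g p.1 p.2 = f p.1 p.2

/-- The operator `M₀ = z ∂/∂z + ū ∂/∂ū + α`. -/
def Mzero (α : ℝ) (f : ℂ → ℂ → ℂ) : ℂ → ℂ → ℂ :=
  fun z w => z * deriv (fun ζ => f ζ w) z + w * deriv (fun ω => f z ω) w + (α : ℂ) * f z w

/-- Inner product on `H_α ⊗ H̄_α`. -/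
def innerHT (α : ℝ) (f g : ℂ → ℂ → ℂ) : ℂ :=
  (((α - 1) ^ 2 / π ^ 2 : ℝ) : ℂ) *
    ∫ p in Disk ×ˢ Disk,
      f p.1 p.2 * starRingEnd ℂ (g p.1 p.2) * (wt α p.1 : ℂ) * (wt α p.2 : ℂ)

lemma measurableSet_Disk : MeasurableSet Disk := isOpen_ball.measurableSet

lemma one_sub_norm_sq_pos {z : ℂ} (hz : z ∈ Disk) : 0 < 1 - ‖z‖ ^ 2 := by
  have h : ‖z‖ < 1 := by simpa [Disk] using hz
  nlinarith [norm_nonneg z]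

lemma measurable_wt (α : ℝ) : Measurable (wt α) := by
  unfold wt
  fun_prop

lemma wt_nonneg (α : ℝ) {z : ℂ} (hz : z ∈ Disk) : 0 ≤ wt α z :=
  Real.rpow_nonneg (one_sub_norm_sq_pos hz).le _

lemma rotation_mem_Disk (a : Circle) {z : ℂ} : rotation a z ∈ Disk ↔ z ∈ Disk := by
  rw [Disk, mem_ball_zero_iff, mem_ball_zero_iff, LinearIsometryEquiv.norm_map]

lemma wt_rotation (α : ℝ) (a : Circle) (z : ℂ) : wt α (rotation a z) = wt α z := by
  rw [wt, LinearIsometryEquiv.norm_map, wt]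

/-- A point on the ray of angle `θ` is at distance at least `|θ| / π` from `1`. -/
lemma abs_div_pi_le_norm_one_sub {t θ : ℝ} (ht : 0 ≤ t) (hθ : |θ| ≤ π) :
    |θ| / π ≤ ‖1 - t * (Real.cos θ + Real.sin θ * Complex.I)‖ := by
  have hsq : ‖1 - t * (Real.cos θ + Real.sin θ * Complex.I)‖ ^ 2
      = (1 - t * Real.cos θ) ^ 2 + (t * Real.sin θ) ^ 2 := by
    rw [← Complex.normSq_eq_norm_sq, Complex.normSq_apply]
    simp [-Complex.ofReal_cos, -Complex.ofReal_sin]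
    ring
  have hcs := Real.sin_sq_add_cos_sq θ
  refine le_of_sq_le_sq ?_ (norm_nonneg _)
  rw [hsq]
  rcases le_or_gt |θ| (π / 2) with h | h
  · have h1 : |θ| / π ≤ |Real.sin θ| := by
      refine le_trans ?_ (Real.mul_abs_le_abs_sin h)
      have : 0 ≤ |θ| / π := by positivity
      rw [div_mul_eq_mul_div, mul_div_assoc]
      linarith
    have h2 : (|θ| / π) ^ 2 ≤ Real.sin θ ^ 2 := by
      rw [← sq_abs (Real.sin θ)]
      gcongr
    nlinarith [sq_nonneg (t - Real.cos θ)]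
  · have hcos : Real.cos θ ≤ 0 := by
      rw [← Real.cos_abs]
      exact Real.cos_nonpos_of_pi_div_two_le_of_le h.le (by linarith [Real.pi_pos])
    have h2 : (|θ| / π) ^ 2 ≤ 1 := by
      have : |θ| / π ≤ 1 := (div_le_one Real.pi_pos).2 hθ
      exact pow_le_one₀ (by positivity) this
    nlinarith [mul_nonneg ht (neg_nonneg.2 hcos), sq_nonneg (t * Real.cos θ),
      sq_nonneg (t * Real.sin θ)]

lemma integrableOn_one_sub_rpow {r : ℝ} (hr : -1 < r) :
    IntegrableOn (fun x : ℝ => (1 - x) ^ r) (Ioo 0 1) := by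
  have h := (intervalIntegral.intervalIntegrable_rpow' (a := 0) (b := 1) hr).comp_sub_left 1
  have h' := h.symm
  simp only [sub_zero, sub_self] at h'
  exact ((intervalIntegrable_iff_integrableOn_Ioo_of_le zero_le_one).1 h')

lemma integrableOn_abs_rpow {r : ℝ} (hr : -1 < r) :
    IntegrableOn (fun x : ℝ => |x| ^ r) (Ioo (-π) π) := by
  have h : IntervalIntegrable (fun x : ℝ => |x| ^ r) volume 0 π := by
    refine (intervalIntegral.intervalIntegrable_rpow' (a := 0) (b := π) hr).congr ?_
    intro x hx
    rw [uIoc_of_le Real.pi_pos.le] at hx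
    simp [abs_of_pos hx.1]
  have h' : IntervalIntegrable (fun x : ℝ => |x| ^ r) volume (-π) 0 := by
    have := (IntervalIntegrable.iff_comp_neg (f := fun x : ℝ => |x| ^ r)).1 h
    simpa using this.symm
  exact (intervalIntegrable_iff_integrableOn_Ioo_of_le (by linarith [Real.pi_pos])).1 (h'.trans h)

lemma one_sub_sq_rpow_le {γ r : ℝ} (hγ : 1 < γ) (h0 : 0 < r) (h1 : r < 1) :
    (1 - r ^ 2) ^ (γ - 2) ≤ 2 ^ (γ - 1) * (1 - r) ^ (γ - 2) := by
  have hpos : 0 < 1 - r := by linarith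
  have hfac : 1 - r ^ 2 = (1 + r) * (1 - r) := by ring
  rw [hfac, Real.mul_rpow (by linarith) hpos.le]
  gcongr
  calc (1 + r) ^ (γ - 2) ≤ (1 + r) ^ (γ - 1) :=
        Real.rpow_le_rpow_of_exponent_le (by linarith) (by linarith)
    _ ≤ 2 ^ (γ - 1) := Real.rpow_le_rpow (by linarith) (by linarith) (by linarith)

/-- Uniform bound for the weighted integrals of `|1 - tu|^(-3/4)` over the disk, `t ≥ 0`. -/
lemma exists_lintegral_wt_mul_le_of_nonneg {γ : ℝ} (hγ : 1 < γ) :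
    ∃ C : ENNReal, C ≠ ⊤ ∧ ∀ t : ℝ, 0 ≤ t →
      ∫⁻ u in Disk, ENNReal.ofReal (wt γ u * ‖1 - t * u‖ ^ (-(3 / 4) : ℝ)) ≤ C := by
  set A : ℝ → ENNReal := fun r => ENNReal.ofReal (2 ^ (γ - 1) * (1 - r) ^ (γ - 2)) with hA
  set B : ℝ → ENNReal := fun θ => ENNReal.ofReal (π ^ (3 / 4 : ℝ) * |θ| ^ (-(3 / 4) : ℝ)) with hB
  have hAm : Measurable A := by fun_prop
  have hBm : Measurable B := by fun_prop
  refine ⟨(∫⁻ r in Ioo 0 1, A r) * ∫⁻ θ in Ioo (-π) π, B θ, ENNReal.mul_ne_top ?_ ?_, ?_⟩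
  · have := ((integrableOn_one_sub_rpow (r := γ - 2) (by linarith)).const_mul
      (2 ^ (γ - 1))).lintegral_lt_top
    exact this.ne
  · have := ((integrableOn_abs_rpow (r := -(3 / 4)) (by norm_num)).const_mul
      (π ^ (3 / 4 : ℝ))).lintegral_lt_top
    exact this.ne
  intro t ht
  rw [← lintegral_prod_mul hAm.aemeasurable hBm.aemeasurable,
    Measure.prod_restrict, ← Measure.volume_eq_prod,
    ← lintegral_indicator measurableSet_Disk, ← Complex.lintegral_comp_polarCoord_symm,
    ← lintegral_indicator (measurableSet_Ioo.prod measurableSet_Ioo),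
    ← lintegral_indicator polarCoord.open_target.measurableSet]
  have hne : ∀ᵐ p : ℝ × ℝ, p.2 ≠ 0 :=
    Measure.quasiMeasurePreserving_snd.ae (Measure.ae_ne volume (0 : ℝ))
  refine lintegral_mono_ae (hne.mono fun p h0 => ?_)
  by_cases hp : p ∈ polarCoord.target
  swap
  · rw [indicator_of_notMem hp]
    exact zero_le
  rw [indicator_of_mem hp]
  obtain ⟨hr, hθ⟩ : 0 < p.1 ∧ p.2 ∈ Ioo (-π) π := by simpa [polarCoord] using hp
  have hnorm : ‖Complex.polarCoord.symm p‖ = p.1 := by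
    simp [abs_of_pos hr]
  by_cases hd : p.1 < 1
  swap
  · have : Complex.polarCoord.symm p ∉ Disk := by
      simpa [Disk, -Complex.polarCoord_symm_apply, hnorm] using hd
    rw [indicator_of_notMem this]
    simp
  have hmem : Complex.polarCoord.symm p ∈ Disk := by
    simpa [Disk, -Complex.polarCoord_symm_apply, hnorm] using hd
  rw [indicator_of_mem hmem, indicator_of_mem (show p ∈ Ioo (0 : ℝ) 1 ×ˢ Ioo (-π) π from
    ⟨⟨hr, hd⟩, hθ⟩)]
  simp only [hA, hB, smul_eq_mul]
  have h1 : wt γ (Complex.polarCoord.symm p) ≤ 2 ^ (γ - 1) * (1 - p.1) ^ (γ - 2) := by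
    rw [wt, hnorm]
    exact one_sub_sq_rpow_le hγ hr hd
  have h2 : ‖1 - t * Complex.polarCoord.symm p‖ ^ (-(3 / 4) : ℝ)
      ≤ π ^ (3 / 4 : ℝ) * |p.2| ^ (-(3 / 4) : ℝ) := by
    have h := abs_div_pi_le_norm_one_sub (t := t * p.1) (mul_nonneg ht hr.le)
      (abs_le.2 ⟨hθ.1.le, hθ.2.le⟩)
    have e : (1 : ℂ) - t * Complex.polarCoord.symm p
        = 1 - (t * p.1 : ℝ) * (Real.cos p.2 + Real.sin p.2 * Complex.I) := by
      rw [Complex.polarCoord_symm_apply]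
      push_cast
      ring
    rw [e]
    refine (Real.rpow_le_rpow_of_nonpos (by positivity) h (by norm_num)).trans_eq ?_
    rw [Real.div_rpow (abs_nonneg _) Real.pi_pos.le, Real.rpow_neg Real.pi_pos.le, div_inv_eq_mul,
      mul_comm]
  rw [← ENNReal.ofReal_mul hr.le, ← ENNReal.ofReal_mul (by have : 0 ≤ 1 - p.1 := by linarith
                                                           positivity)]
  apply ENNReal.ofReal_le_ofReal
  have hw := wt_nonneg γ hmem
  calc _ ≤ 1 * (wt γ (Complex.polarCoord.symm p) *
        ‖1 - t * Complex.polarCoord.symm p‖ ^ (-(3 / 4) : ℝ)) := by gcongr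
    _ ≤ _ := by rw [one_mul]; gcongr

/-- Uniform bound for the weighted integrals of `|1 - wu|^(-3/4)` over the disk, `w ∈ ℂ`. -/
lemma exists_lintegral_wt_mul_le {γ : ℝ} (hγ : 1 < γ) :
    ∃ C : ENNReal, C ≠ ⊤ ∧ ∀ w : ℂ,
      ∫⁻ u in Disk, ENNReal.ofReal (wt γ u * ‖1 - w * u‖ ^ (-(3 / 4) : ℝ)) ≤ C := by
  obtain ⟨C, hC, h⟩ := exists_lintegral_wt_mul_le_of_nonneg hγ
  refine ⟨C, hC, fun w => ?_⟩
  set a : Circle := Circle.exp w.arg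
  have hw : w = ‖w‖ * (a : ℂ) := by
    simp [a, Circle.coe_exp, Complex.norm_mul_exp_arg_mul_I]
  have hmp := (rotation a).measurePreserving
  have hpre : rotation a ⁻¹' Disk = Disk := by
    ext z
    exact rotation_mem_Disk a
  have key := hmp.setLIntegral_comp_preimage_emb (rotation a).toHomeomorph.measurableEmbedding
    (fun u => ENNReal.ofReal (wt γ u * ‖1 - (‖w‖ : ℝ) * u‖ ^ (-(3 / 4) : ℝ))) Disk
  rw [hpre] at key
  refine le_trans (le_of_eq ?_) (h ‖w‖ (norm_nonneg w))
  rw [← key]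
  refine lintegral_congr fun u => ?_
  have e2 : (‖w‖ : ℂ) * rotation a u = w * u := by
    rw [rotation_apply]
    nth_rw 2 [hw]
    ring
  rw [wt_rotation, e2]

/-- `|1 - z̄u|² ≥ (1 - |z|²)(1 - |u|²)`. -/
lemma mul_one_sub_norm_sq_le (z u : ℂ) :
    (1 - ‖z‖ ^ 2) * (1 - ‖u‖ ^ 2) ≤ ‖1 - starRingEnd ℂ z * u‖ ^ 2 := by
  simp only [← Complex.normSq_eq_norm_sq, Complex.normSq_apply, Complex.sub_re, Complex.sub_im,
    Complex.mul_re, Complex.mul_im, Complex.conj_re, Complex.conj_im, Complex.one_re,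
    Complex.one_im]
  nlinarith [sq_nonneg (z.re - u.re), sq_nonneg (z.im - u.im)]

lemma wt_mul_norm_rpow_le (α : ℝ) (hα : 1 < α) {z u : ℂ} (hz : z ∈ Disk) (hu : u ∈ Disk) :
    ‖1 - starRingEnd ℂ z * u‖ ^ (1 / 2 - α) * wt α z * wt α u ≤
      wt ((α + 1) / 2) z * wt ((α + 1) / 2) u *
        ‖1 - starRingEnd ℂ z * u‖ ^ (-(1 / 2) : ℝ) := by
  have ha := one_sub_norm_sq_pos hz
  have hb := one_sub_norm_sq_pos hu
  have hle := mul_one_sub_norm_sq_le z u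
  have hn : 0 < ‖1 - starRingEnd ℂ z * u‖ := by
    by_contra h
    have : ‖1 - starRingEnd ℂ z * u‖ = 0 := le_antisymm (not_lt.1 h) (norm_nonneg _)
    rw [this] at hle
    nlinarith [mul_pos ha hb]
  set N := ‖1 - starRingEnd ℂ z * u‖
  have h1 : N ^ (1 / 2 - α) = N ^ (-(1 / 2) : ℝ) * (N ^ 2) ^ (-((α - 1) / 2)) := by
    rw [← Real.rpow_natCast, ← Real.rpow_mul hn.le, ← Real.rpow_add hn]
    congr 1
    push_cast
    ring
  have h2 : (N ^ 2) ^ (-((α - 1) / 2)) ≤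
      (1 - ‖z‖ ^ 2) ^ (-((α - 1) / 2)) * (1 - ‖u‖ ^ 2) ^ (-((α - 1) / 2)) := by
    rw [← Real.mul_rpow ha.le hb.le]
    exact Real.rpow_le_rpow_of_nonpos (mul_pos ha hb) hle (by linarith)
  have h3 : ∀ {x : ℝ}, 0 < x → x ^ (-((α - 1) / 2)) * x ^ (α - 2) = x ^ ((α + 1) / 2 - 2) := by
    intro x hx
    rw [← Real.rpow_add hx]
    congr 1
    ring
  have hwz := wt_nonneg α hz
  have hwu := wt_nonneg α hu
  calc N ^ (1 / 2 - α) * wt α z * wt α u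
      ≤ N ^ (-(1 / 2) : ℝ) * ((1 - ‖z‖ ^ 2) ^ (-((α - 1) / 2)) *
          (1 - ‖u‖ ^ 2) ^ (-((α - 1) / 2))) * wt α z * wt α u := by
        rw [h1]
        gcongr
    _ = _ := by
        simp only [wt]
        rw [← h3 ha, ← h3 hb]
        ring

lemma mul_rpow_neg_half_le {x y z : ℝ} (hx : 0 ≤ x) (hy : 0 ≤ y) (hz : 0 ≤ z) :
    x ^ (-(1 / 2) : ℝ) * y ^ (-(1 / 2) : ℝ) * z ^ (-(1 / 2) : ℝ) ≤
      x ^ (-(3 / 4) : ℝ) * y ^ (-(3 / 4) : ℝ) + x ^ (-(3 / 4) : ℝ) * z ^ (-(3 / 4) : ℝ) +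
        y ^ (-(3 / 4) : ℝ) * z ^ (-(3 / 4) : ℝ) := by
  have h2 : ∀ {t : ℝ}, 0 ≤ t → t ^ (-(1 / 2) : ℝ) = (t ^ (-(1 / 4) : ℝ)) ^ 2 := by
    intro t ht
    rw [← Real.rpow_natCast, ← Real.rpow_mul ht]
    norm_num
  have h3 : ∀ {t : ℝ}, 0 ≤ t → t ^ (-(3 / 4) : ℝ) = (t ^ (-(1 / 4) : ℝ)) ^ 3 := by
    intro t ht
    rw [← Real.rpow_natCast, ← Real.rpow_mul ht]
    norm_num
  rw [h2 hx, h2 hy, h2 hz, h3 hx, h3 hy, h3 hz]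
  have amgm : ∀ {a b c : ℝ}, 0 ≤ a → 0 ≤ b → 0 ≤ c → a * b * c ≤ a ^ 3 + b ^ 3 + c ^ 3 := by
    intro a b c ha hb hc
    nlinarith [mul_nonneg (add_nonneg (add_nonneg ha hb) hc) (add_nonneg (add_nonneg
      (sq_nonneg (a - b)) (sq_nonneg (b - c))) (sq_nonneg (a - c))), mul_nonneg (mul_nonneg ha hb) hc]
  have px := Real.rpow_nonneg hx (-(1 / 4))
  have py := Real.rpow_nonneg hy (-(1 / 4))
  have pz := Real.rpow_nonneg hz (-(1 / 4))
  have := amgm (mul_nonneg px py) (mul_nonneg px pz) (mul_nonneg py pz)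
  linarith [this]

lemma norm_cpow_le_rpow_mul (x c : ℂ) : ‖x ^ c‖ ≤ Real.exp (π * |c.im|) * ‖x‖ ^ c.re := by
  refine (Complex.norm_cpow_le x c).trans ?_
  rw [div_eq_inv_mul, ← Real.exp_neg]
  gcongr
  calc -(x.arg * c.im) ≤ |x.arg * c.im| := neg_le_abs _
    _ = |x.arg| * |c.im| := abs_mul _ _
    _ ≤ π * |c.im| := by gcongr; exact Complex.abs_arg_le_pi x

/-- A majorant of the weighted kernel. -/
def Kmajorant (γ : ℝ) (p : ℂ × ℂ) : ℝ :=
  wt γ p.1 * wt γ p.2 *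
    (‖1 - p.1‖ ^ (-(3 / 4) : ℝ) * ‖1 - p.2‖ ^ (-(3 / 4) : ℝ) +
      ‖1 - p.1‖ ^ (-(3 / 4) : ℝ) * ‖1 - starRingEnd ℂ p.1 * p.2‖ ^ (-(3 / 4) : ℝ) +
      ‖1 - p.2‖ ^ (-(3 / 4) : ℝ) * ‖1 - starRingEnd ℂ p.1 * p.2‖ ^ (-(3 / 4) : ℝ))

lemma norm_Kker_mul_wt_le (α : ℝ) (hα : 1 < α) (s : ℝ) :
    ∃ C : ℝ, ∀ p ∈ Disk ×ˢ Disk,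
      ‖Kker α 0 s p.1 p.2 * (wt α p.1 : ℂ) * (wt α p.2 : ℂ)‖ ≤
        C * Kmajorant ((α + 1) / 2) p := by
  refine ⟨Real.exp (π * |s|) ^ 3, fun p ⟨hz, hu⟩ => ?_⟩
  have hwz := wt_nonneg α hz
  have hwu := wt_nonneg α hu
  have hgz := wt_nonneg ((α + 1) / 2) hz
  have hgu := wt_nonneg ((α + 1) / 2) hu
  have b1 := norm_cpow_le_rpow_mul (1 - starRingEnd ℂ p.1) (-(1 / 2 : ℂ) - Complex.I * s)
  have b2 := norm_cpow_le_rpow_mul (1 - p.2) (-(1 / 2 : ℂ) - Complex.I * s)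
  have b3 := norm_cpow_le_rpow_mul (1 - starRingEnd ℂ p.1 * p.2)
    (-((α : ℂ) - 1 / 2 - Complex.I * s))
  have hc : ‖1 - starRingEnd ℂ p.1‖ = ‖1 - p.1‖ := by
    rw [← Complex.norm_conj (1 - p.1)]
    simp
  have r1 : (-(1 / 2 : ℂ) - Complex.I * s).re = -(1 / 2) := by simp
  have i1 : |(-(1 / 2 : ℂ) - Complex.I * s).im| = |s| := by simp
  have r3 : (-((α : ℂ) - 1 / 2 - Complex.I * s)).re = 1 / 2 - α := by simp
  have i3 : |(-((α : ℂ) - 1 / 2 - Complex.I * s)).im| = |s| := by simp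
  rw [r1, i1, hc] at b1
  rw [r1, i1] at b2
  rw [r3, i3] at b3
  set E := Real.exp (π * |s|)
  have hE : 0 < E := Real.exp_pos _
  have hw := wt_mul_norm_rpow_le α hα hz hu
  have ham := mul_rpow_neg_half_le (norm_nonneg (1 - p.1)) (norm_nonneg (1 - p.2))
    (norm_nonneg (1 - starRingEnd ℂ p.1 * p.2))
  have hK : Kker α 0 s p.1 p.2 = (1 - starRingEnd ℂ p.1) ^ (-(1 / 2 : ℂ) - Complex.I * s) *
      (1 - p.2) ^ (-(1 / 2 : ℂ) - Complex.I * s) *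
      (1 - starRingEnd ℂ p.1 * p.2) ^ (-((α : ℂ) - 1 / 2 - Complex.I * s)) := by
    simp [Kker]
  rw [hK, norm_mul, norm_mul, norm_mul, norm_mul, Complex.norm_real, Complex.norm_real,
    Real.norm_of_nonneg hwz, Real.norm_of_nonneg hwu]
  set X := ‖1 - p.1‖
  set Y := ‖1 - p.2‖
  set Z := ‖1 - starRingEnd ℂ p.1 * p.2‖ with hZ
  calc _ ≤ (E * X ^ (-(1 / 2) : ℝ)) * (E * Y ^ (-(1 / 2) : ℝ)) * (E * Z ^ (1 / 2 - α)) *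
        wt α p.1 * wt α p.2 := by gcongr
    _ = E ^ 3 * (X ^ (-(1 / 2) : ℝ) * Y ^ (-(1 / 2) : ℝ) *
        (Z ^ (1 / 2 - α) * wt α p.1 * wt α p.2)) := by ring
    _ ≤ E ^ 3 * (X ^ (-(1 / 2) : ℝ) * Y ^ (-(1 / 2) : ℝ) *
        (wt ((α + 1) / 2) p.1 * wt ((α + 1) / 2) p.2 * Z ^ (-(1 / 2) : ℝ))) := by gcongr
    _ = E ^ 3 * (wt ((α + 1) / 2) p.1 * wt ((α + 1) / 2) p.2 *
        (X ^ (-(1 / 2) : ℝ) * Y ^ (-(1 / 2) : ℝ) * Z ^ (-(1 / 2) : ℝ))) := by ring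
    _ ≤ _ := by
        rw [Kmajorant]
        gcongr

lemma measurable_Kmajorant (γ : ℝ) : Measurable (Kmajorant γ) := by
  have := measurable_wt γ
  unfold Kmajorant
  fun_prop

lemma integrableOn_Kmajorant {γ : ℝ} (hγ : 1 < γ) :
    IntegrableOn (Kmajorant γ) (Disk ×ˢ Disk) := by
  obtain ⟨C, hC, hbd⟩ := exists_lintegral_wt_mul_le hγ
  have hwm := measurable_wt γ
  have hrm : volume.restrict (Disk ×ˢ Disk)
      = (volume.restrict Disk).prod (volume.restrict Disk) := by
    rw [Measure.prod_restrict, Measure.volume_eq_prod]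
  set T : ℂ → ENNReal := fun u => ENNReal.ofReal (wt γ u * ‖1 - u‖ ^ (-(3 / 4) : ℝ)) with hT
  set S : ℂ → ℂ → ENNReal := fun w u =>
    ENNReal.ofReal (wt γ u * ‖1 - w * u‖ ^ (-(3 / 4) : ℝ)) with hS
  have hTm : Measurable T := by fun_prop
  have hSm : Measurable (fun p : ℂ × ℂ => S (starRingEnd ℂ p.1) p.2) := by fun_prop
  have hSm' : Measurable (fun p : ℂ × ℂ => S (starRingEnd ℂ p.2) p.1) := by fun_prop
  have hTC : ∫⁻ u in Disk, T u ≤ C := by simpa using hbd 1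
  refine ⟨(measurable_Kmajorant γ).aestronglyMeasurable, ?_⟩
  have hle : ∫⁻ p in Disk ×ˢ Disk, ‖Kmajorant γ p‖ₑ ≤ ∫⁻ p in Disk ×ˢ Disk,
      (T p.1 * T p.2 + T p.1 * S (starRingEnd ℂ p.1) p.2 + S (starRingEnd ℂ p.2) p.1 * T p.2) := by
    refine setLIntegral_mono' (measurableSet_Disk.prod measurableSet_Disk) fun p ⟨hz, hu⟩ => ?_
    have hgz := wt_nonneg γ hz
    have hgu := wt_nonneg γ hu
    have hsym : ‖1 - starRingEnd ℂ p.2 * p.1‖ = ‖1 - starRingEnd ℂ p.1 * p.2‖ := by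
      rw [← Complex.norm_conj]
      simp [mul_comm]
    simp only [hT, hS]
    rw [← ENNReal.ofReal_mul (by positivity), ← ENNReal.ofReal_mul (by positivity),
      ← ENNReal.ofReal_mul (by positivity), ← ENNReal.ofReal_add (by positivity) (by positivity),
      ← ENNReal.ofReal_add (by positivity) (by positivity), Real.enorm_of_nonneg (by
        unfold Kmajorant
        positivity), hsym]
    refine ENNReal.ofReal_le_ofReal (le_of_eq ?_)
    unfold Kmajorant
    ring
  refine lt_of_le_of_lt (hle.trans ?_) (show C * C + C * C + C * C < ⊤ by
    simp [ENNReal.mul_lt_top_iff, hC.lt_top])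
  rw [hrm, lintegral_add_left (by fun_prop), lintegral_add_left (by fun_prop)]
  refine add_le_add (add_le_add ?_ ?_) ?_
  · rw [lintegral_prod_mul hTm.aemeasurable hTm.aemeasurable]
    gcongr
  · rw [lintegral_prod _ (by fun_prop)]
    calc _ ≤ ∫⁻ z in Disk, T z * C := by
          refine lintegral_mono fun z => ?_
          dsimp only
          rw [lintegral_const_mul _ (by fun_prop)]
          gcongr
          exact hbd _
      _ ≤ C * C := by
          rw [lintegral_mul_const _ hTm]
          gcongr
  · rw [lintegral_prod_symm _ (by fun_prop)]
    calc _ ≤ ∫⁻ u in Disk, C * T u := by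
          refine lintegral_mono fun u => ?_
          dsimp only
          rw [lintegral_mul_const _ (by fun_prop)]
          gcongr
          exact hbd _
      _ ≤ C * C := by
          rw [lintegral_const_mul _ hTm]
          gcongr

lemma Kker_rotation (α φ : ℝ) (s z u : ℂ) :
    Kker α φ s (rotation (Circle.exp φ) z) (rotation (Circle.exp φ) u) = Kker α 0 s z u := by
  have hc : starRingEnd ℂ (Complex.exp (φ * Complex.I)) = Complex.exp (-(φ * Complex.I)) := by
    rw [← Complex.exp_conj]
    simp
  have he : Complex.exp (-(φ * Complex.I)) * Complex.exp (φ * Complex.I) = 1 := by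
    rw [← Complex.exp_add]
    simp
  have e1 : starRingEnd ℂ (rotation (Circle.exp φ) z) * Complex.exp (Complex.I * φ)
      = starRingEnd ℂ z := by
    rw [rotation_apply, Circle.coe_exp, map_mul, hc, mul_comm Complex.I]
    linear_combination starRingEnd ℂ z * he
  have e2 : rotation (Circle.exp φ) u * Complex.exp (-(Complex.I * φ)) = u := by
    rw [rotation_apply, Circle.coe_exp, mul_comm Complex.I]
    linear_combination u * he
  have e3 : starRingEnd ℂ (rotation (Circle.exp φ) z) * rotation (Circle.exp φ) u
      = starRingEnd ℂ z * u := by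
    rw [rotation_apply, rotation_apply, Circle.coe_exp, map_mul, hc]
    linear_combination starRingEnd ℂ z * u * he
  simp only [Kker]
  rw [e1, e2, e3]
  simp

/-- By rotation invariance, the angle can be moved from the kernel to the function. -/
lemma Jop_eq_integral_rotation (α : ℝ) (h : ℂ → ℂ → ℂ) (φ : ℝ) (s : ℂ) :
    Jop α h φ s = ∫ p in Disk ×ˢ Disk, Kker α 0 s p.1 p.2 * (wt α p.1 : ℂ) * (wt α p.2 : ℂ) *
      h (rotation (Circle.exp φ) p.1) (starRingEnd ℂ (rotation (Circle.exp φ) p.2)) := by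
  set a := Circle.exp φ with ha
  have hmp : MeasurePreserving (Prod.map (rotation a) (rotation a))
      (volume : Measure (ℂ × ℂ)) volume :=
    (rotation a).measurePreserving.prod (rotation a).measurePreserving
  have hemb : MeasurableEmbedding (Prod.map (rotation a) (rotation a)) :=
    ((rotation a).toHomeomorph.prodCongr (rotation a).toHomeomorph).measurableEmbedding
  have hpre : Prod.map (rotation a) (rotation a) ⁻¹' (Disk ×ˢ Disk) = Disk ×ˢ Disk := by
    ext p
    simp only [mem_preimage, mem_prod, Prod.map_fst, Prod.map_snd, rotation_mem_Disk]
  rw [Jop, ← hmp.setIntegral_preimage_emb hemb, hpre]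
  refine integral_congr_ae (ae_of_all _ fun p => ?_)
  simp only [Prod.map_fst, Prod.map_snd, wt_rotation, ha, Kker_rotation]
  ring

/-- The operator `z ∂/∂z - ū ∂/∂ū`. -/
def rotDeriv (f : ℂ → ℂ → ℂ) (z w : ℂ) : ℂ :=
  z * deriv (fun ζ => f ζ w) z - w * deriv (fun ω => f z ω) w

lemma deriv_fst_eq_fderiv {f : ℂ → ℂ → ℂ} {z w : ℂ}
    (hf : DifferentiableAt ℂ (fun p : ℂ × ℂ => f p.1 p.2) (z, w)) :
    deriv (fun ζ => f ζ w) z = fderiv ℂ (fun p : ℂ × ℂ => f p.1 p.2) (z, w) (1, 0) := by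
  have h : HasDerivAt (fun ζ : ℂ => (ζ, w)) (1, 0) z :=
    (hasDerivAt_id z).prodMk (hasDerivAt_const z w)
  exact (hf.hasFDerivAt.comp_hasDerivAt z h).deriv

lemma deriv_snd_eq_fderiv {f : ℂ → ℂ → ℂ} {z w : ℂ}
    (hf : DifferentiableAt ℂ (fun p : ℂ × ℂ => f p.1 p.2) (z, w)) :
    deriv (fun ω => f z ω) w = fderiv ℂ (fun p : ℂ × ℂ => f p.1 p.2) (z, w) (0, 1) := by
  have h : HasDerivAt (fun ω : ℂ => (z, ω)) (0, 1) w :=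
    (hasDerivAt_const w z).prodMk (hasDerivAt_id w)
  exact (hf.hasFDerivAt.comp_hasDerivAt w h).deriv

lemma rotDeriv_eq_fderiv {f : ℂ → ℂ → ℂ} {z w : ℂ}
    (hf : DifferentiableAt ℂ (fun p : ℂ × ℂ => f p.1 p.2) (z, w)) :
    rotDeriv f z w = fderiv ℂ (fun p : ℂ × ℂ => f p.1 p.2) (z, w) (z, -w) := by
  have e : ((z, -w) : ℂ × ℂ) = z • (1, 0) - w • (0, 1) := by simp
  rw [e, map_sub, map_smul, map_smul, ← deriv_fst_eq_fderiv hf, ← deriv_snd_eq_fderiv hf]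
  rfl

lemma hasDerivAt_comp_rotation {f : ℂ → ℂ → ℂ} {z u : ℂ} {ψ : ℝ}
    (hf : DifferentiableAt ℂ (fun p : ℂ × ℂ => f p.1 p.2)
      (rotation (Circle.exp ψ) z, starRingEnd ℂ (rotation (Circle.exp ψ) u))) :
    HasDerivAt (fun x : ℝ => f (rotation (Circle.exp x) z)
        (starRingEnd ℂ (rotation (Circle.exp x) u)))
      (Complex.I * rotDeriv f (rotation (Circle.exp ψ) z)
        (starRingEnd ℂ (rotation (Circle.exp ψ) u))) ψ := by
  have hrot : ∀ v : ℂ, HasDerivAt (fun x : ℝ => rotation (Circle.exp x) v)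
      (Complex.I * rotation (Circle.exp ψ) v) ψ := by
    intro v
    have h1 : HasDerivAt (fun x : ℝ => Complex.exp (x * Complex.I) * v)
        (Complex.exp (ψ * Complex.I) * (1 * Complex.I) * v) ψ :=
      (((Complex.ofRealCLM.hasDerivAt (x := ψ)).mul_const Complex.I).cexp).mul_const v
    simp only [rotation_apply, Circle.coe_exp]
    convert h1 using 1
    ring
  have hconj : HasDerivAt (fun x : ℝ => starRingEnd ℂ (rotation (Circle.exp x) u))
      (-(Complex.I * starRingEnd ℂ (rotation (Circle.exp ψ) u))) ψ := by
    have := (hrot u).star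
    simpa using this
  have := (hf.hasFDerivAt.restrictScalars ℝ).comp_hasDerivAt ψ ((hrot z).prodMk hconj)
  rw [rotDeriv_eq_fderiv hf, ← smul_eq_mul, ← map_smul]
  simpa [Function.comp_def] using this

lemma conj_mem_Disk {z : ℂ} (hz : z ∈ Disk) : starRingEnd ℂ z ∈ Disk := by
  simpa [Disk] using hz

lemma isOpen_Disk_prod : IsOpen (Disk ×ˢ Disk) := isOpen_ball.prod isOpen_ball

/-- Cauchy estimates: a function in `W` and its image under `z ∂/∂z - ū ∂/∂ū` are bounded. -/
lemma MemW.exists_bound {α : ℝ} {f : ℂ → ℂ → ℂ} (hf : MemW α f) :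
    ∃ M : ℝ, ∀ z ∈ Disk, ∀ w ∈ Disk, ‖f z w‖ ≤ M ∧ ‖rotDeriv f z w‖ ≤ M := by
  obtain ⟨-, δ, hδ, g, hg, hgf⟩ := hf
  have hsub : closedBall (0 : ℂ) (1 + δ / 2) ⊆ ball 0 (1 + δ) :=
    closedBall_subset_ball (by linarith)
  obtain ⟨M, hM⟩ := ((isCompact_closedBall (0 : ℂ) (1 + δ / 2)).prod
    (isCompact_closedBall (0 : ℂ) (1 + δ / 2))).exists_bound_of_continuousOn
    (hg.continuousOn.mono (prod_mono hsub hsub))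
  have hin : ∀ {z : ℂ}, z ∈ Disk → z ∈ closedBall (0 : ℂ) (1 + δ / 2) := by
    intro z hz
    have : ‖z‖ < 1 := by simpa [Disk] using hz
    rw [mem_closedBall_zero_iff]
    linarith
  have hcl : ∀ {z : ℂ}, z ∈ Disk → closedBall z (δ / 2) ⊆ closedBall (0 : ℂ) (1 + δ / 2) := by
    intro z hz
    have : dist z 0 < 1 := hz
    exact closedBall_subset_closedBall' (by linarith)
  have hz1 : ∀ z ∈ Disk, ∀ w ∈ Disk, ‖deriv (fun ζ => f ζ w) z‖ ≤ M / (δ / 2) := by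
    intro z hz w hw
    have heq : (fun ζ => f ζ w) =ᶠ[nhds z] fun ζ => g ζ w := by
      filter_upwards [isOpen_ball.mem_nhds hz] with ζ hζ using (hgf (ζ, w) ⟨hζ, hw⟩).symm
    rw [heq.deriv_eq]
    have hd : DifferentiableOn ℂ (fun ζ => g ζ w) (closedBall z (δ / 2)) :=
      hg.comp (f := fun ζ : ℂ => (ζ, w)) (by fun_prop)
        fun ζ hζ => ⟨hsub (hcl hz hζ), hsub (hin hw)⟩
    refine Complex.norm_deriv_le_of_forall_mem_sphere_norm_le (by positivity)
      (hd.diffContOnCl_ball subset_rfl) fun ζ hζ => ?_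
    exact hM (ζ, w) ⟨hcl hz (sphere_subset_closedBall hζ), hin hw⟩
  have hw1 : ∀ z ∈ Disk, ∀ w ∈ Disk, ‖deriv (fun ω => f z ω) w‖ ≤ M / (δ / 2) := by
    intro z hz w hw
    have heq : (fun ω => f z ω) =ᶠ[nhds w] fun ω => g z ω := by
      filter_upwards [isOpen_ball.mem_nhds hw] with ω hω using (hgf (z, ω) ⟨hz, hω⟩).symm
    rw [heq.deriv_eq]
    have hd : DifferentiableOn ℂ (fun ω => g z ω) (closedBall w (δ / 2)) :=
      hg.comp (f := fun ω : ℂ => (z, ω)) (by fun_prop)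
        fun ω hω => ⟨hsub (hin hz), hsub (hcl hw hω)⟩
    refine Complex.norm_deriv_le_of_forall_mem_sphere_norm_le (by positivity)
      (hd.diffContOnCl_ball subset_rfl) fun ω hω => ?_
    exact hM (z, ω) ⟨hin hz, hcl hw (sphere_subset_closedBall hω)⟩
  refine ⟨max M (M / (δ / 2) + M / (δ / 2)), fun z hz w hw => ⟨?_, ?_⟩⟩
  · rw [← hgf (z, w) ⟨hz, hw⟩]
    exact (hM (z, w) ⟨hin hz, hin hw⟩).trans (le_max_left _ _)
  · have nz : ‖z‖ ≤ 1 := (by simpa [Disk] using hz : ‖z‖ < 1).le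
    have nw : ‖w‖ ≤ 1 := (by simpa [Disk] using hw : ‖w‖ < 1).le
    refine le_trans ?_ (le_max_right _ _)
    refine (norm_sub_le _ _).trans (add_le_add ?_ ?_)
    · rw [norm_mul]
      exact (mul_le_of_le_one_left (norm_nonneg _) nz).trans (hz1 z hz w hw)
    · rw [norm_mul]
      exact (mul_le_of_le_one_left (norm_nonneg _) nw).trans (hw1 z hz w hw)

lemma integrableOn_Kker_mul_wt (α : ℝ) (hα : 1 < α) (s : ℝ) :
    IntegrableOn (fun p : ℂ × ℂ => Kker α 0 s p.1 p.2 * (wt α p.1 : ℂ) * (wt α p.2 : ℂ))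
      (Disk ×ˢ Disk) := by
  obtain ⟨C, hC⟩ := norm_Kker_mul_wt_le α hα s
  have hwm := measurable_wt α
  refine Integrable.mono' ((integrableOn_Kmajorant (γ := (α + 1) / 2) (by linarith)).const_mul C)
    (Measurable.aestronglyMeasurable ?_)
    (ae_restrict_of_forall_mem isOpen_Disk_prod.measurableSet hC)
  unfold Kker
  fun_prop

/-- The rotation of `(z, ū)` maps the bidisk into itself. -/
lemma rotation_mem_Disk_prod (a : Circle) {p : ℂ × ℂ} (hp : p ∈ Disk ×ˢ Disk) :
    (rotation a p.1, starRingEnd ℂ (rotation a p.2)) ∈ Disk ×ˢ Disk :=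
  ⟨(rotation_mem_Disk a).2 hp.1, conj_mem_Disk ((rotation_mem_Disk a).2 hp.2)⟩

lemma continuous_rotation_pair (a : Circle) :
    Continuous fun p : ℂ × ℂ => (rotation a p.1, starRingEnd ℂ (rotation a p.2)) :=
  ((rotation a).continuous.comp continuous_fst).prodMk
    (Complex.continuous_conj.comp ((rotation a).continuous.comp continuous_snd))

lemma aestronglyMeasurable_comp_rotation {f : ℂ → ℂ → ℂ}
    (hf : DifferentiableOn ℂ (fun p : ℂ × ℂ => f p.1 p.2) (Disk ×ˢ Disk)) (a : Circle) :
    AEStronglyMeasurable (fun p : ℂ × ℂ => f (rotation a p.1) (starRingEnd ℂ (rotation a p.2)))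
      (volume.restrict (Disk ×ˢ Disk)) :=
  (hf.continuousOn.comp (continuous_rotation_pair a).continuousOn
    fun _ hp => rotation_mem_Disk_prod a hp).aestronglyMeasurable isOpen_Disk_prod.measurableSet

lemma aestronglyMeasurable_rotDeriv_comp_rotation {f : ℂ → ℂ → ℂ}
    (hf : DifferentiableOn ℂ (fun p : ℂ × ℂ => f p.1 p.2) (Disk ×ˢ Disk)) (a : Circle) :
    AEStronglyMeasurable
      (fun p : ℂ × ℂ => rotDeriv f (rotation a p.1) (starRingEnd ℂ (rotation a p.2)))
      (volume.restrict (Disk ×ˢ Disk)) := by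
  set F : ℂ × ℂ → ℂ := fun p => f p.1 p.2
  have h1 := (measurable_fderiv_apply_const ℂ F (1, 0)).comp (continuous_rotation_pair a).measurable
  have h2 := (measurable_fderiv_apply_const ℂ F (0, 1)).comp (continuous_rotation_pair a).measurable
  have hm : Measurable fun p : ℂ × ℂ =>
      rotation a p.1 * fderiv ℂ F (rotation a p.1, starRingEnd ℂ (rotation a p.2)) (1, 0) -
      starRingEnd ℂ (rotation a p.2) *
        fderiv ℂ F (rotation a p.1, starRingEnd ℂ (rotation a p.2)) (0, 1) :=
    ((continuous_rotation_pair a).fst.measurable.mul h1).sub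
      ((continuous_rotation_pair a).snd.measurable.mul h2)
  refine hm.aestronglyMeasurable.congr
    (ae_restrict_of_forall_mem isOpen_Disk_prod.measurableSet fun p hp => ?_)
  have hd := hf.differentiableAt (isOpen_Disk_prod.mem_nhds (rotation_mem_Disk_prod a hp))
  simp only [rotDeriv, F]
  rw [deriv_fst_eq_fderiv hd, deriv_snd_eq_fderiv hd]

/-- Differentiation of `J_α f` in the angle. -/
lemma hasDerivAt_Jop {α : ℝ} (hα : 1 < α) {f : ℂ → ℂ → ℂ} (hf : MemW α f) (φ s : ℝ) :
    HasDerivAt (fun ψ : ℝ => Jop α f ψ s) (Complex.I * Jop α (rotDeriv f) φ s) φ := by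
  obtain ⟨M, hM⟩ := hf.exists_bound
  have hd := hf.1.1
  have hK := integrableOn_Kker_mul_wt α hα s
  have hS := isOpen_Disk_prod.measurableSet
  simp only [Jop_eq_integral_rotation]
  rw [← integral_const_mul]
  set k : ℂ × ℂ → ℂ := fun p => Kker α 0 s p.1 p.2 * (wt α p.1 : ℂ) * (wt α p.2 : ℂ)
  have hMz : ∀ (a : Circle) (p : ℂ × ℂ), p ∈ Disk ×ˢ Disk →
      ‖f (rotation a p.1) (starRingEnd ℂ (rotation a p.2))‖ ≤ M ∧
      ‖rotDeriv f (rotation a p.1) (starRingEnd ℂ (rotation a p.2))‖ ≤ M := fun a p hp =>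
    hM _ (rotation_mem_Disk_prod a hp).1 _ (rotation_mem_Disk_prod a hp).2
  have hmeas : ∀ x : ℝ, AEStronglyMeasurable (fun p : ℂ × ℂ => k p *
      f (rotation (Circle.exp x) p.1) (starRingEnd ℂ (rotation (Circle.exp x) p.2)))
      (volume.restrict (Disk ×ˢ Disk)) := fun x =>
    hK.aestronglyMeasurable.mul (aestronglyMeasurable_comp_rotation hd _)
  refine (hasDerivAt_integral_of_dominated_loc_of_deriv_le (s := univ)
    (bound := fun p => ‖k p‖ * M)
    (F := fun (x : ℝ) (p : ℂ × ℂ) => k p *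
      f (rotation (Circle.exp x) p.1) (starRingEnd ℂ (rotation (Circle.exp x) p.2)))
    (F' := fun (x : ℝ) (p : ℂ × ℂ) => Complex.I * (k p *
      rotDeriv f (rotation (Circle.exp x) p.1) (starRingEnd ℂ (rotation (Circle.exp x) p.2))))
    Filter.univ_mem (Filter.Eventually.of_forall hmeas) ?_ ?_ ?_ (hK.norm.mul_const M) ?_).2
  · refine Integrable.mono' (hK.norm.mul_const M) (hmeas φ)
      (ae_restrict_of_forall_mem hS fun p hp => ?_)
    rw [norm_mul]
    exact mul_le_mul_of_nonneg_left (hMz _ p hp).1 (norm_nonneg _)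
  · exact (hK.aestronglyMeasurable.mul
      (aestronglyMeasurable_rotDeriv_comp_rotation hd _)).const_mul _
  · refine ae_restrict_of_forall_mem hS fun p hp x _ => ?_
    rw [norm_mul, norm_mul, Complex.norm_I, one_mul]
    exact mul_le_mul_of_nonneg_left (hMz _ p hp).2 (norm_nonneg _)
  · refine ae_restrict_of_forall_mem hS fun p hp x _ => ?_
    have h := (hasDerivAt_comp_rotation (hd.differentiableAt
      (isOpen_Disk_prod.mem_nhds (rotation_mem_Disk_prod (Circle.exp x) hp)))).const_mul (k p)
    rwa [mul_left_comm] at h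

/-- For `f ∈ W`: `J_α[(z∂/∂z - ū∂/∂ū)f](φ,s) = (1/i)·∂/∂φ [J_α f](φ,s)`. -/
theorem stmt_6 (α : ℝ) (hα : 1 < α) (f : ℂ → ℂ → ℂ) (hf : MemW α f)
    (φ : ℝ) (hφ : φ ∈ Set.Icc (0:ℝ) (2*π)) (s : ℝ) :
    Jop α (fun z w => z * deriv (fun ζ => f ζ w) z - w * deriv (fun ω => f z ω) w) φ (s : ℂ)
      = (1 / Complex.I) * deriv (fun ψ : ℝ => Jop α f ψ (s : ℂ)) φ := by
  rw [(hasDerivAt_Jop hα hf φ s).deriv, ← mul_assoc, one_div_mul_cancel Complex.I_ne_zero,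
    one_mul]
  rfl
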